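/- Let f : ℝ → ℝ be smooth with globally bounded derivative. Let a, b ∈ C^∞(ℝ) and h ∈ C^∞(ℝ²). Then there exists a unique u ∈ C^∞(ℝ²) with ∂_t²u(x,t) − ∂_x²u(x,t) = f(u(x,t)) + h(x,t) for all (x,t) ∈ ℝ², u(x,0) = a(x) and ∂_t u(x,0) = b(x) for all x ∈ ℝ. -/

import Mathlib

open Real Set Filter MeasureTheory Topology

noncomputable section

/-- The wave operator `∂_t² - ∂_x²` on functions of `(x,t) ∈ ℝ²`. -/
def waveOp (w : ℝ × ℝ → ℝ) (p : ℝ × ℝ) : ℝ :=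
  iteratedDeriv 2 (fun s => w (p.1, s)) p.2 - iteratedDeriv 2 (fun y => w (y, p.2)) p.1

def A1 (G : ℝ × ℝ → ℝ) (p : ℝ × ℝ) : ℝ := ∫ s in (0:ℝ)..p.1, G (s, p.2)
def A2 (G : ℝ × ℝ → ℝ) (p : ℝ × ℝ) : ℝ := ∫ s in (0:ℝ)..p.2, G (p.1, s)

/-- `v1`, `v2` are the two partial derivatives of `v`. -/
def HasPartials (v v1 v2 : ℝ × ℝ → ℝ) : Prop :=
  (∀ x y, HasDerivAt (fun s => v (s, y)) (v1 (x, y)) x) ∧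
  (∀ x y, HasDerivAt (fun s => v (x, s)) (v2 (x, y)) y)

def pd1 (v : ℝ × ℝ → ℝ) (p : ℝ × ℝ) : ℝ := fderiv ℝ v p (1, 0)
def pd2 (v : ℝ × ℝ → ℝ) (p : ℝ × ℝ) : ℝ := fderiv ℝ v p (0, 1)

lemma A1_cont {G : ℝ × ℝ → ℝ} (hG : Continuous G) : Continuous (A1 G) := by
  unfold A1
  apply intervalIntegral.continuous_parametric_intervalIntegral_of_continuous
    (f := fun (p : ℝ × ℝ) s => G (s, p.2))
  · exact hG.comp (by fun_prop)
  · fun_prop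

lemma A2_cont {G : ℝ × ℝ → ℝ} (hG : Continuous G) : Continuous (A2 G) := by
  unfold A2
  apply intervalIntegral.continuous_parametric_intervalIntegral_of_continuous
    (f := fun (p : ℝ × ℝ) s => G (p.1, s))
  · exact hG.comp (by fun_prop)
  · fun_prop

lemma deriv_under {K K' : ℝ → ℝ → ℝ} (hK : Continuous (Function.uncurry K))
    (hK' : Continuous (Function.uncurry K'))
    (hd : ∀ x s, HasDerivAt (fun x => K x s) (K' x s) x) (c d x : ℝ) :
    HasDerivAt (fun x => ∫ s in c..d, K x s) (∫ s in c..d, K' x s) x := by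
  obtain ⟨C, hC⟩ := (((isCompact_Icc (a := x-1) (b := x+1)).prod
    (isCompact_uIcc (a := c) (b := d))).exists_bound_of_continuousOn hK'.continuousOn)
  refine (intervalIntegral.hasDerivAt_integral_of_dominated_loc_of_deriv_le (s := Icc (x-1) (x+1))
    (bound := fun _ => C) (Icc_mem_nhds (by linarith) (by linarith)) ?_ ?_ ?_ ?_ ?_ ?_).2
  · refine Eventually.of_forall fun y => Continuous.aestronglyMeasurable ?_
    exact hK.comp (by fun_prop : Continuous fun s => (y, s))
  · apply Continuous.intervalIntegrable
    exact hK.comp (by fun_prop : Continuous fun s => (x, s))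
  · refine Continuous.aestronglyMeasurable ?_
    exact hK'.comp (by fun_prop : Continuous fun s => (x, s))
  · refine Eventually.of_forall fun s hs y hy => ?_
    exact hC (y, s) ⟨hy, uIoc_subset_uIcc hs⟩
  · simp
  · exact Eventually.of_forall fun s _ y _ => hd y s

lemma ftc {g : ℝ → ℝ} (hg : Continuous g) (x : ℝ) :
    HasDerivAt (fun x => ∫ s in (0:ℝ)..x, g s) (g x) x :=
  intervalIntegral.integral_hasDerivAt_right (hg.intervalIntegrable _ _)
    hg.stronglyMeasurable.stronglyMeasurableAtFilter hg.continuousAt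

lemma A1_partials {G G' : ℝ × ℝ → ℝ} (hG : Continuous G) (hG' : Continuous G')
    (hd : ∀ x y, HasDerivAt (fun s => G (x, s)) (G' (x, y)) y) :
    HasPartials (A1 G) G (A1 G') := by
  refine ⟨fun x y => ?_, fun x y => ?_⟩
  · exact ftc (g := fun s => G (s, y)) (by fun_prop) x
  · exact deriv_under (K := fun y s => G (s, y)) (K' := fun y s => G' (s, y))
      (hG.comp (by fun_prop : Continuous fun p : ℝ × ℝ => (p.2, p.1)))
      (hG'.comp (by fun_prop : Continuous fun p : ℝ × ℝ => (p.2, p.1)))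
      (fun x s => hd s x) _ _ _

lemma A2_partials {G G' : ℝ × ℝ → ℝ} (hG : Continuous G) (hG' : Continuous G')
    (hd : ∀ x y, HasDerivAt (fun s => G (s, y)) (G' (x, y)) x) :
    HasPartials (A2 G) (A2 G') G := by
  refine ⟨fun x y => ?_, fun x y => ?_⟩
  · exact deriv_under (K := fun y s => G (y, s)) (K' := fun y s => G' (y, s))
      hG hG' (fun x s => hd x s) _ _ _
  · exact ftc (g := fun s => G (x, s)) (by fun_prop) y

lemma HasPartials.hasFDerivAt {v v1 v2 : ℝ × ℝ → ℝ} (h : HasPartials v v1 v2)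
    (c1 : Continuous v1) (c2 : Continuous v2) (p : ℝ × ℝ) :
    HasFDerivAt v ((ContinuousLinearMap.toSpanSingleton ℝ (v1 p)).coprod
      (ContinuousLinearMap.toSpanSingleton ℝ (v2 p))) p := by
  have c : Continuous (fun r : ℝ => ContinuousLinearMap.toSpanSingleton ℝ r) :=
    (ContinuousLinearMap.toSpanSingletonCLE (𝕜 := ℝ) (E := ℝ)).continuous
  have := hasStrictFDerivAt_uncurry_coprod (𝕜 := ℝ) (u := p) (f := fun x y => v (x, y))
    (f₁ := fun x y => ContinuousLinearMap.toSpanSingleton ℝ (v1 (x, y)))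
    (f₂ := fun x y => ContinuousLinearMap.toSpanSingleton ℝ (v2 (x, y)))
    (Eventually.of_forall fun q => (h.1 q.1 q.2).hasFDerivAt)
    (Eventually.of_forall fun q => (h.2 q.1 q.2).hasFDerivAt)
    (c.comp c1).continuousAt (c.comp c2).continuousAt
  exact this.hasFDerivAt

lemma HasPartials.contDiff {v v1 v2 : ℝ × ℝ → ℝ} (h : HasPartials v v1 v2) {n : ℕ}
    (c1 : ContDiff ℝ n v1) (c2 : ContDiff ℝ n v2) : ContDiff ℝ (n+1) v := by
  rw [contDiff_succ_iff_fderiv_apply]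
  have key := h.hasFDerivAt c1.continuous c2.continuous
  refine ⟨fun p => (key p).differentiableAt, by simp, fun y => ?_⟩
  have : (fun x => fderiv ℝ v x y) = fun x => y.1 * v1 x + y.2 * v2 x := by
    ext x
    rw [(key x).fderiv]
    simp
  rw [this]
  fun_prop

lemma hasPartials_pd {v : ℝ × ℝ → ℝ} (h : Differentiable ℝ v) :
    HasPartials v (pd1 v) (pd2 v) := by
  refine ⟨fun x y => ?_, fun x y => ?_⟩
  · exact (h (x, y)).hasFDerivAt.comp_hasDerivAt (f := fun s => (s, y)) x
      ((hasDerivAt_id x).prodMk (hasDerivAt_const x y))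
  · exact (h (x, y)).hasFDerivAt.comp_hasDerivAt (f := fun s => (x, s)) y
      ((hasDerivAt_const y x).prodMk (hasDerivAt_id y))

lemma HasPartials.along {v v1 v2 : ℝ × ℝ → ℝ} (h : HasPartials v v1 v2)
    (c1 : Continuous v1) (c2 : Continuous v2) {α β : ℝ → ℝ} {α' β' t : ℝ}
    (hα : HasDerivAt α α' t) (hβ : HasDerivAt β β' t) :
    HasDerivAt (fun s => v (α s, β s)) (α' * v1 (α t, β t) + β' * v2 (α t, β t)) t := by
  have := (h.hasFDerivAt c1 c2 (α t, β t)).comp_hasDerivAt (f := fun s => (α s, β s)) t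
    (hα.prodMk hβ)
  simp at this
  exact this

lemma pd1_contDiff {v : ℝ × ℝ → ℝ} {n : ℕ} (h : ContDiff ℝ (n+1) v) : ContDiff ℝ n (pd1 v) :=
  (contDiff_succ_iff_fderiv_apply.1 h).2.2 _

lemma pd2_contDiff {v : ℝ × ℝ → ℝ} {n : ℕ} (h : ContDiff ℝ (n+1) v) : ContDiff ℝ n (pd2 v) :=
  (contDiff_succ_iff_fderiv_apply.1 h).2.2 _

lemma A1_contDiff (n : ℕ) : ∀ {G : ℝ × ℝ → ℝ}, ContDiff ℝ n G → ContDiff ℝ n (A1 G) := by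
  induction n with
  | zero =>
    intro G hG
    have := A1_cont hG.continuous
    simpa [contDiff_zero] using this
  | succ n ih =>
    intro G hG
    push_cast at hG ⊢
    have hG2 := pd2_contDiff hG
    exact (A1_partials hG.continuous hG2.continuous
      (hasPartials_pd (hG.differentiable (by simp))).2).contDiff (hG.of_le (by simp)) (ih hG2)

lemma A2_contDiff (n : ℕ) : ∀ {G : ℝ × ℝ → ℝ}, ContDiff ℝ n G → ContDiff ℝ n (A2 G) := by
  induction n with
  | zero =>
    intro G hG
    have := A2_cont hG.continuous
    simpa [contDiff_zero] using this
  | succ n ih =>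
    intro G hG
    push_cast at hG ⊢
    have hG2 := pd1_contDiff hG
    exact (A2_partials hG.continuous hG2.continuous
      (hasPartials_pd (hG.differentiable (by simp))).1).contDiff (ih hG2) (hG.of_le (by simp))

/-- The solution operator of `∂_η ∂_ξ w = -G` with vanishing data on the diagonal. -/
def DD (G : ℝ × ℝ → ℝ) (p : ℝ × ℝ) : ℝ :=
  (∫ s in (0:ℝ)..p.1, A2 G (s, s)) + (∫ s in (0:ℝ)..p.2, A1 G (s, s)) - A1 (A2 G) p

def D1 (G : ℝ × ℝ → ℝ) (p : ℝ × ℝ) : ℝ := A2 G (p.1, p.1) - A2 G p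
def D2 (G : ℝ × ℝ → ℝ) (p : ℝ × ℝ) : ℝ := A1 G (p.2, p.2) - A1 G p

lemma W_partials {G : ℝ × ℝ → ℝ} (hG : Continuous G) :
    HasPartials (A1 (A2 G)) (A2 G) (A1 G) :=
  A1_partials (A2_cont hG) hG (fun x y => ftc (g := fun s => G (x, s)) (by fun_prop) y)

lemma DD_partials {G : ℝ × ℝ → ℝ} (hG : Continuous G) :
    HasPartials (DD G) (D1 G) (D2 G) := by
  have W := W_partials hG
  have c1 := A1_cont hG
  have c2 := A2_cont hG
  refine ⟨fun x y => ?_, fun x y => ?_⟩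
  · have := ((ftc (g := fun s => A2 G (s, s)) (by fun_prop) x).add_const
      (∫ s in (0:ℝ)..y, A1 G (s, s))).sub (W.1 x y)
    exact this
  · have := ((ftc (g := fun s => A1 G (s, s)) (by fun_prop) y).const_add
      (∫ s in (0:ℝ)..x, A2 G (s, s))).sub (W.2 x y)
    exact this

lemma D1_cont {G : ℝ × ℝ → ℝ} (hG : Continuous G) : Continuous (D1 G) := by
  have c2 := A2_cont hG
  unfold D1; fun_prop

lemma D2_cont {G : ℝ × ℝ → ℝ} (hG : Continuous G) : Continuous (D2 G) := by
  have c2 := A1_cont hG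
  unfold D2; fun_prop

lemma DD_cont {G : ℝ × ℝ → ℝ} (hG : Continuous G) : Continuous (DD G) :=
  continuous_iff_continuousAt.2 fun p =>
    ((DD_partials hG).hasFDerivAt (D1_cont hG) (D2_cont hG) p).continuousAt

lemma DD_contDiff {G : ℝ × ℝ → ℝ} {n : ℕ} (hG : ContDiff ℝ n G) : ContDiff ℝ (n+1) (DD G) := by
  have c1 := A1_contDiff n hG
  have c2 := A2_contDiff n hG
  refine (DD_partials hG.continuous).contDiff ?_ ?_
  · unfold D1; fun_prop
  · unfold D2; fun_prop

lemma DD_diag {G : ℝ × ℝ → ℝ} (hG : Continuous G) (s : ℝ) : DD G (s, s) = 0 := by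
  have hd : ∀ t, HasDerivAt (fun s => DD G (s, s)) 0 t := by
    intro t
    have := (DD_partials hG).along (D1_cont hG) (D2_cont hG) (hasDerivAt_id t) (hasDerivAt_id t)
    simpa [D1, D2] using this
  have := is_const_of_deriv_eq_zero (fun t => (hd t).differentiableAt) (fun t => (hd t).deriv) s 0
  rw [this]
  simp [DD, A1]

lemma D1_eq {G : ℝ × ℝ → ℝ} (hG : Continuous G) (x y : ℝ) :
    D1 G (x, y) = ∫ q in y..x, G (x, q) := by
  have c : Continuous fun q => G (x, q) := by fun_prop
  simp only [D1, A2]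
  rw [intervalIntegral.integral_interval_sub_left] <;> exact c.intervalIntegrable _ _

lemma DD_eq {G : ℝ × ℝ → ℝ} (hG : Continuous G) (x y : ℝ) :
    DD G (x, y) = ∫ p in y..x, D1 G (p, y) := by
  have c1 := D1_cont hG
  rw [intervalIntegral.integral_eq_sub_of_hasDerivAt (f := fun p => DD G (p, y))
    (fun p _ => (DD_partials hG).1 p y)
    (Continuous.intervalIntegrable (by fun_prop) _ _), DD_diag hG, sub_zero]

lemma D1_bound {G : ℝ × ℝ → ℝ} (hG : Continuous G) {R M l : ℝ} (hl : 0 < l)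
    (hM : 0 ≤ M)
    (hb : ∀ p q, |p| ≤ R → |q| ≤ R → |G (p, q)| ≤ M * cosh (l * (p - q)))
    {x y : ℝ} (hx : |x| ≤ R) (hy : |y| ≤ R) :
    |D1 G (x, y)| ≤ M / l * |sinh (l * (x - y))| := by
  rw [D1_eq hG]
  have h1 := intervalIntegral.norm_integral_le_abs_of_norm_le (μ := volume) (a := y) (b := x)
    (f := fun q => G (x, q)) (g := fun q => M * cosh (l * (x - q))) ?_ ?_
  · have h2 : ∫ q in y..x, M * cosh (l * (x - q)) = M / l * sinh (l * (x - y)) := by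
      rw [intervalIntegral.integral_eq_sub_of_hasDerivAt
        (f := fun q => - (M / l * sinh (l * (x - q))))]
      · simp
      · intro q _
        have h3 : HasDerivAt (fun q => l * (x - q)) (l * (-1)) q :=
          ((hasDerivAt_id q).const_sub x).const_mul l
        have := ((h3.sinh).const_mul (M / l)).neg
        convert! this using 1
        field_simp
      · apply Continuous.intervalIntegrable; fun_prop
    rw [h2, abs_mul, abs_of_nonneg (div_nonneg hM hl.le)] at h1
    exact h1
  · refine (ae_restrict_iff' measurableSet_uIoc).2 (Eventually.of_forall fun q hq => ?_)
    refine hb x q hx ?_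
    have := uIoc_subset_uIcc hq
    rw [abs_le] at *
    exact ⟨(le_inf hy.1 hx.1).trans this.1, this.2.trans (sup_le hy.2 hx.2)⟩
  · apply Continuous.intervalIntegrable; fun_prop

lemma int_sinh {M l : ℝ} (hl : 0 < l) (x y : ℝ) :
    ∫ p in y..x, M / l * sinh (l * (p - y)) = M / l ^ 2 * (cosh (l * (x - y)) - 1) := by
  rw [intervalIntegral.integral_eq_sub_of_hasDerivAt
    (f := fun p => M / l ^ 2 * cosh (l * (p - y)))]
  · simp; ring
  · intro q _
    have h3 : HasDerivAt (fun q => l * (q - y)) (l * 1) q :=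
      ((hasDerivAt_id q).sub_const y).const_mul l
    have := (h3.cosh).const_mul (M / l ^ 2)
    convert! this using 1
    field_simp
  · apply Continuous.intervalIntegrable; fun_prop

lemma DD_bound {G : ℝ × ℝ → ℝ} (hG : Continuous G) {R M l : ℝ} (hl : 0 < l)
    (hM : 0 ≤ M)
    (hb : ∀ p q, |p| ≤ R → |q| ≤ R → |G (p, q)| ≤ M * cosh (l * (p - q)))
    {x y : ℝ} (hx : |x| ≤ R) (hy : |y| ≤ R) :
    |DD G (x, y)| ≤ M / l ^ 2 * cosh (l * (x - y)) := by
  have hMl : 0 ≤ M / l := div_nonneg hM hl.le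
  have hMl2 : 0 ≤ M / l ^ 2 := by positivity
  have hfin : M / l ^ 2 * (cosh (l * (x - y)) - 1) ≤ M / l ^ 2 * cosh (l * (x - y)) :=
    mul_le_mul_of_nonneg_left (by linarith) hMl2
  refine le_trans ?_ hfin
  rw [DD_eq hG, ← int_sinh hl]
  rw [abs_le] at hx hy
  rcases le_total y x with hxy | hxy
  · rw [← Real.norm_eq_abs]
    refine intervalIntegral.norm_integral_le_of_norm_le hxy (Eventually.of_forall fun p hp => ?_) ?_
    · have := D1_bound hG hl hM hb (x := p) (y := y)
        (abs_le.2 ⟨by linarith [hp.1], by linarith [hp.2]⟩) (abs_le.2 hy)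
      rwa [abs_of_nonneg (sinh_nonneg_iff.2 (mul_nonneg hl.le (by linarith [hp.1])))] at this
    · apply Continuous.intervalIntegrable; fun_prop
  · rw [intervalIntegral.integral_symm, abs_neg, intervalIntegral.integral_symm x y,
      ← intervalIntegral.integral_neg,
      ← Real.norm_eq_abs]
    refine intervalIntegral.norm_integral_le_of_norm_le hxy (Eventually.of_forall fun p hp => ?_) ?_
    · have := D1_bound hG hl hM hb (x := p) (y := y)
        (abs_le.2 ⟨by linarith [hp.1], by linarith [hp.2]⟩) (abs_le.2 hy)
      rwa [abs_of_nonpos (sinh_nonpos_iff.2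
        (mul_nonpos_of_nonneg_of_nonpos hl.le (by linarith [hp.2]))), mul_neg] at this
    · apply Continuous.intervalIntegrable; fun_prop

/-- The contraction estimate in the weighted norm. -/
lemma DD_contract {G w : ℝ × ℝ → ℝ} (hG : Continuous G) {R M K : ℝ} (hK : 0 ≤ K)
    (hM : 0 ≤ M) (hGw : ∀ p, |G p| ≤ K * |w p|)
    (hb : ∀ p q, |p| ≤ R → |q| ≤ R → |w (p, q)| ≤ M * cosh ((K + 1) * (p - q)))
    {x y : ℝ} (hx : |x| ≤ R) (hy : |y| ≤ R) :
    |DD G (x, y)| ≤ M * (1 / 2) * cosh ((K + 1) * (x - y)) := by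
  refine (DD_bound hG (M := K * M) (l := K + 1) (by linarith) (mul_nonneg hK hM)
    (fun p q hp hq => ?_) hx hy).trans ?_
  · rw [mul_assoc]
    exact (hGw _).trans (mul_le_mul_of_nonneg_left (hb p q hp hq) hK)
  · refine mul_le_mul_of_nonneg_right ?_ (cosh_pos _).le
    rw [div_le_iff₀ (by positivity)]
    nlinarith [mul_nonneg hM (sq_nonneg K)]

lemma DD_sub {G H : ℝ × ℝ → ℝ} (hG : Continuous G) (hH : Continuous H) (p : ℝ × ℝ) :
    DD (fun q => G q - H q) p = DD G p - DD H p := by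
  obtain ⟨x, y⟩ := p
  have c := D1_cont hG
  have c' := D1_cont hH
  have hGH : Continuous (fun q => G q - H q) := hG.sub hH
  rw [DD_eq hG, DD_eq hH, DD_eq hGH, ← intervalIntegral.integral_sub]
  · refine intervalIntegral.integral_congr fun p _ => ?_
    rw [D1_eq hG, D1_eq hH, D1_eq hGH, ← intervalIntegral.integral_sub] <;>
    · apply Continuous.intervalIntegrable; fun_prop
  all_goals apply Continuous.intervalIntegrable; fun_prop

lemma exists_bd {w : ℝ × ℝ → ℝ} (hw : Continuous w) (R K : ℝ) :
    ∃ M, 0 ≤ M ∧ ∀ p q, |p| ≤ R → |q| ≤ R → |w (p, q)| ≤ M * cosh (K * (p - q)) := by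
  obtain ⟨C, hC⟩ := (((isCompact_Icc (a := -R) (b := R)).prod
    (isCompact_Icc (a := -R) (b := R))).exists_bound_of_continuousOn hw.continuousOn)
  refine ⟨max C 0, le_max_right _ _, fun p q hp hq => ?_⟩
  have h1 : |w (p, q)| ≤ C := hC (p, q) ⟨abs_le.1 hp, abs_le.1 hq⟩
  have h2 := one_le_cosh (K * (p - q))
  have h3 := le_max_left C 0
  have h4 := le_max_right C 0
  nlinarith

lemma DD_unique {G w : ℝ × ℝ → ℝ} (hG : Continuous G) (hw : Continuous w) {K : ℝ} (hK : 0 ≤ K)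
    (hGw : ∀ p, |G p| ≤ K * |w p|) (heq : ∀ p, w p = DD G p) (p : ℝ × ℝ) : w p = 0 := by
  obtain ⟨x, y⟩ := p
  set R := max |x| |y| with hR
  obtain ⟨M, hM, hb⟩ := exists_bd hw R (K + 1)
  have key : ∀ n : ℕ, ∀ p q, |p| ≤ R → |q| ≤ R →
      |w (p, q)| ≤ M * (1 / 2) ^ n * cosh ((K + 1) * (p - q)) := by
    intro n
    induction n with
    | zero => simpa using hb
    | succ n ih =>
      intro p q hp hq
      rw [heq]
      have := DD_contract hG hK (by positivity) hGw ih hp hq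
      rwa [pow_succ, ← mul_assoc]
  have lim : Tendsto (fun n : ℕ => M * (1 / 2 : ℝ) ^ n * cosh ((K + 1) * (x - y))) atTop (𝓝 0) := by
    have := ((tendsto_pow_atTop_nhds_zero_of_lt_one (r := (1 / 2 : ℝ)) (by norm_num)
      (by norm_num)).const_mul M).mul_const (cosh ((K + 1) * (x - y)))
    simpa using this
  have := ge_of_tendsto' lim (fun n => key n x y (le_max_left _ _) (le_max_right _ _))
  exact abs_nonpos_iff.1 this

lemma exists_fixed {V : ℝ × ℝ → ℝ} (hV : Continuous V) {F : ℝ × ℝ → ℝ → ℝ}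
    (hF : Continuous (Function.uncurry F)) {K : ℝ} (hK : 0 ≤ K)
    (hL : ∀ p y z, |F p y - F p z| ≤ K * |y - z|) :
    ∃ v : ℝ × ℝ → ℝ, Continuous v ∧ ∀ p, v p = V p + DD (fun q => F q (v q)) p := by
  have hFc : ∀ v : ℝ × ℝ → ℝ, Continuous v → Continuous (fun q => F q (v q)) := fun v hv =>
    hF.comp (continuous_id.prodMk hv)
  let T : (ℝ × ℝ → ℝ) → (ℝ × ℝ → ℝ) := fun v p => V p + DD (fun q => F q (v q)) p
  have hTc : ∀ v, Continuous v → Continuous (T v) := fun v hv => hV.add (DD_cont (hFc v hv))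
  have hT : ∀ v w : ℝ × ℝ → ℝ, Continuous v → Continuous w → ∀ R M : ℝ, 0 ≤ M →
      (∀ p q, |p| ≤ R → |q| ≤ R → |v (p, q) - w (p, q)| ≤ M * cosh ((K + 1) * (p - q))) →
      ∀ p q, |p| ≤ R → |q| ≤ R →
        |T v (p, q) - T w (p, q)| ≤ M * (1 / 2) * cosh ((K + 1) * (p - q)) := by
    intro v w hv hw R M hM hb p q hp hq
    have e : T v (p, q) - T w (p, q) = DD (fun r => F r (v r) - F r (w r)) (p, q) := by
      rw [DD_sub (hFc v hv) (hFc w hw)]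
      simp only [T]; ring
    rw [e]
    exact DD_contract (w := fun r => v r - w r) ((hFc v hv).sub (hFc w hw)) hK hM
      (fun r => hL r _ _) hb hp hq
  let s : ℕ → ℝ × ℝ → ℝ := fun n => T^[n] 0
  have hs : ∀ n, s (n + 1) = T (s n) := fun n => Function.iterate_succ_apply' T n 0
  have hsc : ∀ n, Continuous (s n) := by
    intro n
    induction n with
    | zero => exact continuous_const
    | succ n ih => rw [hs]; exact hTc _ ih
  have hex := fun R : ℝ => exists_bd ((hsc 0).sub (hsc 1)) R (K + 1)
  choose M hM hMb using hex
  have step : ∀ R n p q, |p| ≤ R → |q| ≤ R →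
      |s n (p, q) - s (n + 1) (p, q)| ≤ M R * (1 / 2) ^ n * cosh ((K + 1) * (p - q)) := by
    intro R n
    induction n with
    | zero => simpa using hMb R
    | succ n ih =>
      intro p q hp hq
      rw [hs (n + 1)]
      nth_rewrite 1 [hs n]
      have := hT _ _ (hsc n) (hsc (n + 1)) R _ (mul_nonneg (hM R) (by positivity)) ih p q hp hq
      rwa [pow_succ, ← mul_assoc]
  have step' : ∀ R p q, |p| ≤ R → |q| ≤ R → ∀ n, 
      dist (s n (p, q)) (s (n + 1) (p, q)) ≤ (M R * cosh ((K + 1) * (p - q))) * (1 / 2) ^ n := by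
    intro R p q hp hq n
    rw [Real.dist_eq]
    refine (step R n p q hp hq).trans (le_of_eq (by ring))
  have hlim : ∀ r : ℝ × ℝ, ∃ z, Tendsto (fun n => s n r) atTop (𝓝 z) := by
    rintro ⟨p, q⟩
    exact cauchySeq_tendsto_of_complete (cauchySeq_of_le_geometric (1 / 2) _ (by norm_num)
      (step' (max |p| |q|) p q (le_max_left _ _) (le_max_right _ _)))
  choose v hv using hlim
  have bd : ∀ R n p q, |p| ≤ R → |q| ≤ R →
      |s n (p, q) - v (p, q)| ≤ (2 * M R * (1 / 2) ^ n) * cosh ((K + 1) * (p - q)) := by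
    intro R n p q hp hq
    have := dist_le_of_le_geometric_of_tendsto (1 / 2) _ (by norm_num) (step' R p q hp hq)
      (hv (p, q)) n
    rw [Real.dist_eq] at this
    refine this.trans (le_of_eq (by ring))
  have limz : ∀ A : ℝ, Tendsto (fun n : ℕ => A * (1 / 2 : ℝ) ^ n) atTop (𝓝 0) := by
    intro A
    have := ((tendsto_pow_atTop_nhds_zero_of_lt_one (r := (1 / 2 : ℝ)) (by norm_num)
      (by norm_num)).const_mul A)
    simpa using this
  have hvc : Continuous v := by
    refine continuous_iff_continuousAt.2 fun r => ?_
    have hu : TendstoUniformlyOn s v atTop (Metric.closedBall 0 (‖r‖ + 1)) := by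
      rw [Metric.tendstoUniformlyOn_iff]
      intro ε hε
      have := (limz (2 * M (‖r‖ + 1) * cosh ((K + 1) * (2 * (‖r‖ + 1))))).eventually_lt_const hε
      filter_upwards [this] with n hn
      rintro ⟨p, q⟩ hpq
      rw [mem_closedBall_zero_iff, Prod.norm_def, sup_le_iff] at hpq
      obtain ⟨hp, hq⟩ := hpq
      simp only [Real.norm_eq_abs] at hp hq
      rw [dist_comm, Real.dist_eq]
      refine ((bd _ n p q hp hq).trans ?_).trans_lt hn
      have hc : cosh ((K + 1) * (p - q)) ≤ cosh ((K + 1) * (2 * (‖r‖ + 1))) := by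
        rw [cosh_le_cosh, abs_mul, abs_mul]
        refine mul_le_mul_of_nonneg_left ?_ (abs_nonneg _)
        rw [abs_of_nonneg (a := 2 * (‖r‖ + 1)) (by positivity)]
        exact (abs_sub p q).trans (by linarith)
      have := mul_le_mul_of_nonneg_left hc
        (mul_nonneg (mul_nonneg zero_le_two (hM (‖r‖ + 1))) (by positivity : (0:ℝ) ≤ (1 / 2) ^ n))
      linarith
    have := hu.continuousOn (Frequently.of_forall fun n => (hsc n).continuousOn)
    exact this.continuousAt (Metric.closedBall_mem_nhds_of_mem (by simp))
  refine ⟨v, hvc, fun r => ?_⟩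
  obtain ⟨p, q⟩ := r
  have h1 : Tendsto (fun n => s (n + 1) (p, q)) atTop (𝓝 (v (p, q))) :=
    (hv (p, q)).comp (tendsto_add_atTop_nat 1)
  have h2 : Tendsto (fun n => s (n + 1) (p, q)) atTop (𝓝 (T v (p, q))) := by
    rw [tendsto_iff_dist_tendsto_zero]
    set R := max |p| |q| with hR
    refine squeeze_zero (fun _ => dist_nonneg) (fun n => ?_)
      (limz (2 * M R * (1 / 2) * cosh ((K + 1) * (p - q))))
    rw [Real.dist_eq, hs]
    refine (hT _ _ (hsc n) hvc R _ (mul_nonneg (mul_nonneg zero_le_two (hM R)) (by positivity))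
      (bd R n) p q (le_max_left _ _) (le_max_right _ _)).trans (le_of_eq (by ring))
  exact tendsto_nhds_unique h1 h2

lemma smooth_pd1 {v : ℝ × ℝ → ℝ} (h : ContDiff ℝ (⊤ : ℕ∞) v) : ContDiff ℝ (⊤ : ℕ∞) (pd1 v) :=
  contDiff_infty.2 fun n => pd1_contDiff (by exact_mod_cast contDiff_infty.1 h (n + 1))

lemma smooth_pd2 {v : ℝ × ℝ → ℝ} (h : ContDiff ℝ (⊤ : ℕ∞) v) : ContDiff ℝ (⊤ : ℕ∞) (pd2 v) :=
  contDiff_infty.2 fun n => pd2_contDiff (by exact_mod_cast contDiff_infty.1 h (n + 1))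

lemma smooth_partials {v : ℝ × ℝ → ℝ} (h : ContDiff ℝ (⊤ : ℕ∞) v) :
    HasPartials v (pd1 v) (pd2 v) := hasPartials_pd (h.differentiable (by simp))

lemma pd_symm {v : ℝ × ℝ → ℝ} (h : ContDiff ℝ (⊤ : ℕ∞) v) (p : ℝ × ℝ) :
    pd1 (pd2 v) p = pd2 (pd1 v) p := by
  have hd : DifferentiableAt ℝ (fderiv ℝ v) p :=
    ((contDiff_infty.1 h 2).fderiv_right (m := 1) (by norm_num)).differentiable (by simp) p
  have key : ∀ e e' : ℝ × ℝ, fderiv ℝ (fun q => fderiv ℝ v q e) p e' =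
      fderiv ℝ (fderiv ℝ v) p e' e := by
    intro e e'
    rw [fderiv_clm_apply hd (differentiableAt_const e)]
    simp
  have hs : IsSymmSndFDerivAt ℝ v p :=
    (contDiff_infty.1 h 2).contDiffAt.isSymmSndFDerivAt (by simp)
  unfold pd1 pd2
  rw [key, key]
  exact hs _ _

lemma along_smooth {v : ℝ × ℝ → ℝ} (h : ContDiff ℝ (⊤ : ℕ∞) v) {α β : ℝ → ℝ} {α' β' t : ℝ}
    (hα : HasDerivAt α α' t) (hβ : HasDerivAt β β' t) :
    HasDerivAt (fun s => v (α s, β s)) (α' * pd1 v (α t, β t) + β' * pd2 v (α t, β t)) t :=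
  (smooth_partials h).along (smooth_pd1 h).continuous (smooth_pd2 h).continuous hα hβ

lemma iter2 {g g' : ℝ → ℝ} {t g'' : ℝ} (h1 : ∀ s, HasDerivAt g (g' s) s)
    (h2 : HasDerivAt g' g'' t) : iteratedDeriv 2 g t = g'' := by
  rw [iteratedDeriv_succ, iteratedDeriv_one, show deriv g = g' from funext fun s => (h1 s).deriv]
  exact h2.deriv

lemma waveOp_char {v : ℝ × ℝ → ℝ} (h : ContDiff ℝ (⊤ : ℕ∞) v) (x t : ℝ) :
    waveOp (fun p => v (p.1 + p.2, p.1 - p.2)) (x, t) = -4 * pd2 (pd1 v) (x + t, x - t) := by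
  have h1 := smooth_pd1 h
  have h2 := smooth_pd2 h
  have a1 : ∀ x s : ℝ, HasDerivAt (fun s => x + s) 1 s := fun x s => (hasDerivAt_id s).const_add x
  have a2 : ∀ x s : ℝ, HasDerivAt (fun s => x - s) (-1) s := fun x s =>
    (hasDerivAt_id s).const_sub x
  have a3 : ∀ x s : ℝ, HasDerivAt (fun s => s + x) 1 s := fun x s => (hasDerivAt_id s).add_const x
  have a4 : ∀ x s : ℝ, HasDerivAt (fun s => s - x) 1 s := fun x s => (hasDerivAt_id s).sub_const x
  unfold waveOp
  simp only
  rw [iter2 (fun s => along_smooth h (a1 x s) (a2 x s))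
      (((along_smooth h1 (a1 x t) (a2 x t)).const_mul 1).add
        ((along_smooth h2 (a1 x t) (a2 x t)).const_mul (-1))),
    iter2 (fun s => along_smooth h (a3 t s) (a4 t s))
      (((along_smooth h1 (a3 t x) (a4 t x)).const_mul 1).add
        ((along_smooth h2 (a3 t x) (a4 t x)).const_mul 1)), pd_symm h]
  ring

lemma D1_d2 {G : ℝ × ℝ → ℝ} (hG : Continuous G) (x y : ℝ) :
    HasDerivAt (fun s => D1 G (x, s)) (- G (x, y)) y := by
  have := (ftc (g := fun s => G (x, s)) (by fun_prop) y).const_sub (A2 G (x, x))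
  exact this

lemma linear_rep {v G : ℝ × ℝ → ℝ} (h : ContDiff ℝ (⊤ : ℕ∞) v) (hG : Continuous G)
    (h0 : ∀ s, v (s, s) = 0) (h1 : ∀ s, pd1 v (s, s) = 0)
    (h2 : ∀ p, pd2 (pd1 v) p = - G p) (p : ℝ × ℝ) : v p = DD G p := by
  have e1 : ∀ x y, pd1 v (x, y) = D1 G (x, y) := by
    intro x y
    have hd : ∀ t, HasDerivAt (fun s => pd1 v (x, s) - D1 G (x, s)) 0 t := by
      intro t
      have := ((smooth_partials (smooth_pd1 h)).2 x t).sub (D1_d2 hG x t)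
      simp only [h2, sub_self] at this
      exact this
    have := is_const_of_deriv_eq_zero (fun t => (hd t).differentiableAt)
      (fun t => (hd t).deriv) y x
    simp only [h1, D1, sub_self] at this
    simp only [D1]
    linarith
  obtain ⟨x, y⟩ := p
  have hd : ∀ t, HasDerivAt (fun s => v (s, y) - DD G (s, y)) 0 t := by
    intro t
    have := ((smooth_partials h).1 t y).sub ((DD_partials hG).1 t y)
    simp only [e1, sub_self] at this
    exact this
  have := is_const_of_deriv_eq_zero (fun t => (hd t).differentiableAt)
    (fun t => (hd t).deriv) x y
  simp only [h0, DD_diag hG, sub_self] at this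
  linarith

lemma prim_smooth {b : ℝ → ℝ} (hb : ContDiff ℝ (⊤ : ℕ∞) b) :
    ContDiff ℝ (⊤ : ℕ∞) (fun x => ∫ s in (0:ℝ)..x, b s) := by
  rw [contDiff_infty_iff_deriv]
  have := ftc hb.continuous
  refine ⟨fun x => (this x).differentiableAt, ?_⟩
  rwa [show deriv (fun x => ∫ s in (0:ℝ)..x, b s) = b from funext fun x => (this x).deriv]

theorem exist_part
    (f : ℝ → ℝ) (hf : ContDiff ℝ (⊤ : ℕ∞) f)
    (L : ℝ) (hL0 : 0 ≤ L) (hfL : ∀ y z : ℝ, |f y - f z| ≤ L * |y - z|)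
    (a b : ℝ → ℝ) (ha : ContDiff ℝ (⊤ : ℕ∞) a) (hb : ContDiff ℝ (⊤ : ℕ∞) b)
    (h : ℝ × ℝ → ℝ) (hh : ContDiff ℝ (⊤ : ℕ∞) h) :
    ∃ u : ℝ × ℝ → ℝ, ContDiff ℝ (⊤ : ℕ∞) u ∧
      (∀ p : ℝ × ℝ, waveOp u p = f (u p) + h p) ∧
      (∀ x : ℝ, u (x, 0) = a x) ∧
      (∀ x : ℝ, deriv (fun s => u (x, s)) 0 = b x) := by
  have hB := prim_smooth hb
  have hBd := ftc hb.continuous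
  set B : ℝ → ℝ := fun x => ∫ s in (0:ℝ)..x, b s with hBdef
  let V : ℝ × ℝ → ℝ := fun p => (a p.1 + a p.2) / 2 + (B p.1 - B p.2) / 2
  have hV : ContDiff ℝ (⊤ : ℕ∞) V := by simp only [V]; fun_prop
  let H : ℝ × ℝ → ℝ := fun p => h ((p.1 + p.2) / 2, (p.1 - p.2) / 2)
  have hH : ContDiff ℝ (⊤ : ℕ∞) H := hh.comp (by fun_prop)
  let F : ℝ × ℝ → ℝ → ℝ := fun p y => (f y + H p) / 4
  have hfc := hf.continuous
  have hHc := hH.continuous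
  obtain ⟨v, hvc, hv⟩ := exists_fixed hV.continuous (F := F)
    (by simp only [F, Function.uncurry_def]; fun_prop) hL0 (by
      intro p y z
      have e : F p y - F p z = (f y - f z) / 4 := by simp only [F]; ring
      rw [e, abs_div]
      refine le_trans ?_ (hfL y z)
      exact div_le_self (abs_nonneg _) (by norm_num))
  set G : ℝ × ℝ → ℝ := fun q => F q (v q) with hGdef
  have hGc : Continuous G := by simp only [hGdef, F]; fun_prop
  have hvn : ∀ n : ℕ, ContDiff ℝ n v := by
    intro n
    induction n with
    | zero => exact contDiff_zero.2 hvc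
    | succ n ih =>
      have hfn : ContDiff ℝ n f := contDiff_infty.1 hf n
      have hHn : ContDiff ℝ n H := contDiff_infty.1 hH n
      have : ContDiff ℝ n G := by simp only [hGdef, F]; fun_prop
      rw [show v = fun p => V p + DD G p from funext hv]
      push_cast
      exact (by exact_mod_cast contDiff_infty.1 hV (n + 1) : ContDiff ℝ (n+1) V).add
        (DD_contDiff this)
  have hvs : ContDiff ℝ (⊤ : ℕ∞) v := contDiff_infty.2 hvn
  have had : ∀ x, HasDerivAt a (deriv a x) x := fun x =>
    (ha.differentiable (by simp) x).hasDerivAt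
  have P := smooth_partials hvs
  have p1 : ∀ x y, pd1 v (x, y) = deriv a x / 2 + b x / 2 + D1 G (x, y) := by
    intro x y
    refine (P.1 x y).unique ?_
    rw [show v = fun p => V p + DD G p from funext hv]
    exact ((((had x).add_const (a y)).div_const 2).add (((hBd x).sub_const (B y)).div_const 2)).add
      ((DD_partials hGc).1 x y)
  have p2 : ∀ x y, pd2 v (x, y) = deriv a y / 2 + - b y / 2 + D2 G (x, y) := by
    intro x y
    refine (P.2 x y).unique ?_
    rw [show v = fun p => V p + DD G p from funext hv]
    exact ((((had y).const_add (a x)).div_const 2).add (((hBd y).const_sub (B x)).div_const 2)).add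
      ((DD_partials hGc).2 x y)
  have p12 : ∀ x y, pd2 (pd1 v) (x, y) = - G (x, y) := by
    intro x y
    refine ((smooth_partials (smooth_pd1 hvs)).2 x y).unique ?_
    simp only [p1]
    exact (D1_d2 hGc x y).const_add _
  refine ⟨fun p => v (p.1 + p.2, p.1 - p.2), hvs.comp (by fun_prop), ?_, ?_, ?_⟩
  · rintro ⟨x, t⟩
    rw [waveOp_char hvs, p12]
    simp only [hGdef, F, H]
    rw [show ((x + t + (x - t)) / 2, (x + t - (x - t)) / 2) = (x, t) by ext <;> simp]
    ring
  · intro x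
    simp only [add_zero, sub_zero]
    rw [hv, DD_diag hGc]
    simp [V]
  · intro x
    have := (along_smooth hvs ((hasDerivAt_id (0:ℝ)).const_add x)
      ((hasDerivAt_id (0:ℝ)).const_sub x)).deriv
    simp only [id, add_zero, sub_zero, p1, p2, D1, D2] at this
    refine this.trans ?_
    ring

theorem unique_part
    (f : ℝ → ℝ) (hf : ContDiff ℝ (⊤ : ℕ∞) f)
    (L : ℝ) (hL0 : 0 ≤ L) (hfL : ∀ y z : ℝ, |f y - f z| ≤ L * |y - z|)
    (a b : ℝ → ℝ) (h : ℝ × ℝ → ℝ) (u u' : ℝ × ℝ → ℝ)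
    (hu : ContDiff ℝ (⊤ : ℕ∞) u) (hu' : ContDiff ℝ (⊤ : ℕ∞) u')
    (hw : ∀ p : ℝ × ℝ, waveOp u p = f (u p) + h p)
    (hw' : ∀ p : ℝ × ℝ, waveOp u' p = f (u' p) + h p)
    (h0 : ∀ x : ℝ, u (x, 0) = a x) (h0' : ∀ x : ℝ, u' (x, 0) = a x)
    (h1 : ∀ x : ℝ, deriv (fun s => u (x, s)) 0 = b x)
    (h1' : ∀ x : ℝ, deriv (fun s => u' (x, s)) 0 = b x) : u = u' := by
  let c : ℝ × ℝ → ℝ × ℝ := fun p => ((p.1 + p.2) / 2, (p.1 - p.2) / 2)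
  have hc : ContDiff ℝ (⊤ : ℕ∞) c := by simp only [c]; fun_prop
  have gen : ∀ u : ℝ × ℝ → ℝ, ContDiff ℝ (⊤ : ℕ∞) u →
      (∀ p : ℝ × ℝ, waveOp u p = f (u p) + h p) → (∀ x : ℝ, u (x, 0) = a x) →
      (∀ x : ℝ, deriv (fun s => u (x, s)) 0 = b x) →
      (∀ s, (u ∘ c) (s, s) = a s) ∧ (∀ s, pd1 (u ∘ c) (s, s) = (deriv a s + b s) / 2) ∧
      (∀ p, pd2 (pd1 (u ∘ c)) p = - ((f ((u ∘ c) p) + h (c p)) / 4)) := by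
    intro u hu hw h0 h1
    have hs : ContDiff ℝ (⊤ : ℕ∞) (u ∘ c) := hu.comp hc
    refine ⟨fun s => ?_, fun s => ?_, ?_⟩
    · simp [c, h0]
    · have e1 : pd1 u (s, 0) = deriv a s := by
        rw [← ((smooth_partials hu).1 s 0).deriv]
        simp only [h0]
      have e2 : pd2 u (s, 0) = b s := by
        rw [← h1, ((smooth_partials hu).2 s 0).deriv]
      have e3 := along_smooth hu (((hasDerivAt_id s).add_const s).div_const 2)
        (((hasDerivAt_id s).sub_const s).div_const 2)
      have e4 := ((smooth_partials hs).1 s s).unique e3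
      rw [e4]
      simp [e1, e2]
      ring
    · rintro ⟨x, y⟩
      have e := waveOp_char hs ((x + y) / 2) ((x - y) / 2)
      have e5 : (fun p : ℝ × ℝ => (u ∘ c) (p.1 + p.2, p.1 - p.2)) = u := by
        ext ⟨p, q⟩
        simp [c]
      rw [e5, hw] at e
      rw [show (x + y) / 2 + (x - y) / 2 = x by ring, show (x + y) / 2 - (x - y) / 2 = y by ring] at e
      simp only [Function.comp, c] at e ⊢
      linarith
  obtain ⟨g1, g2, g3⟩ := gen u hu hw h0 h1
  obtain ⟨g1', g2', g3'⟩ := gen u' hu' hw' h0' h1'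
  have hs : ContDiff ℝ (⊤ : ℕ∞) (u ∘ c) := hu.comp hc
  have hs' : ContDiff ℝ (⊤ : ℕ∞) (u' ∘ c) := hu'.comp hc
  set v := u ∘ c
  set v' := u' ∘ c
  have q1 : pd1 (fun p => v p - v' p) = fun p => pd1 v p - pd1 v' p := by
    ext p
    simp only [pd1]
    rw [fderiv_fun_sub (hs.differentiable (by simp) p) (hs'.differentiable (by simp) p)]
    rfl
  have q2 : pd2 (fun p => pd1 v p - pd1 v' p) = fun p => pd2 (pd1 v) p - pd2 (pd1 v') p := by
    ext p
    have d := (smooth_pd1 hs).differentiable (by simp) p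
    have d' := (smooth_pd1 hs').differentiable (by simp) p
    unfold pd2
    rw [fderiv_fun_sub d d']
    rfl
  have hfc := hf.continuous
  have hvc := hs.continuous
  have hvc' := hs'.continuous
  have hG : Continuous fun p => (f (v p) - f (v' p)) / 4 := by fun_prop
  have rep := linear_rep (v := fun p => v p - v' p) (G := fun p => (f (v p) - f (v' p)) / 4)
    (hs.sub hs') hG (fun s => by simp [g1, g1'])
    (fun s => by rw [q1]; simp [g2, g2'])
    (fun p => by rw [q1, q2]; simp only [g3, g3']; ring)
  have z := DD_unique hG (hvc.sub hvc') hL0 (fun p => by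
      rw [abs_div]
      refine le_trans ?_ (hfL _ _)
      exact div_le_self (abs_nonneg _) (by norm_num)) rep
  ext ⟨x, t⟩
  have : v (x + t, x - t) - v' (x + t, x - t) = 0 := z (x + t, x - t)
  simp only [v, v', Function.comp, c] at this
  rw [show ((x + t + (x - t)) / 2, (x + t - (x - t)) / 2) = (x, t) by ext <;> simp] at this
  linarith

/-- Global existence and uniqueness of the classical smooth solution of the
one-dimensional semilinear wave equation with globally Lipschitz smooth
nonlinearity and smooth data. -/
theorem classical_existence_uniqueness
    (f : ℝ → ℝ) (hf : ContDiff ℝ (⊤ : ℕ∞) f)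
    (L : ℝ) (hfL : ∀ y : ℝ, |deriv f y| ≤ L)
    (a b : ℝ → ℝ) (ha : ContDiff ℝ (⊤ : ℕ∞) a) (hb : ContDiff ℝ (⊤ : ℕ∞) b)
    (h : ℝ × ℝ → ℝ) (hh : ContDiff ℝ (⊤ : ℕ∞) h) :
    ∃! u : ℝ × ℝ → ℝ, ContDiff ℝ (⊤ : ℕ∞) u ∧
      (∀ p : ℝ × ℝ, waveOp u p = f (u p) + h p) ∧
      (∀ x : ℝ, u (x, 0) = a x) ∧
      (∀ x : ℝ, deriv (fun s => u (x, s)) 0 = b x) := by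
  have hL0 : 0 ≤ L := (abs_nonneg _).trans (hfL 0)
  have hLip : ∀ y z : ℝ, |f y - f z| ≤ L * |y - z| := by
    intro y z
    exact convex_univ.norm_image_sub_le_of_norm_deriv_le (f := f)
      (fun x _ => hf.differentiable (by simp) x) (fun x _ => hfL x) (mem_univ z) (mem_univ y)
  obtain ⟨u, hu, hw, h0, h1⟩ := exist_part f hf L hL0 hLip a b ha hb h hh
  refine ⟨u, ⟨hu, hw, h0, h1⟩, ?_⟩
  rintro u' ⟨hu', hw', h0', h1'⟩
  exact unique_part f hf L hL0 hLip a b h u' u hu' hu hw' hw h0' h0 h1' h1
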